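/- Explicit Bessel solution of the multiplicative Goursat integral equation: let T > 0 and let f, g : [0,T] → ℝ be integrable with F(t) := ∫_0^t f(u) du ≥ 0 and G(t) := ∫_0^t g(u) du ≥ 0 for all t ∈ [0,T]. Then the unique continuous solution of φ(s,t) = 1 + ∫_0^s ∫_0^t f(r) g(v) φ(r,v) dr dv for s, t ∈ [0,T] is φ(s,t) = I_0(2√(F(s)G(t))), where I_0(z) = ∑_{k≥0} (z/2)^{2k}/(k!)² is the modified Bessel function of the first kind of order zero. -/

import Mathlib

open MeasureTheory

/-- The modified Bessel function of the first kind of order zero,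
`I₀(z) = ∑_{k ≥ 0} (z/2)^{2k}/(k!)²`. -/
noncomputable def besselI0 (z : ℝ) : ℝ :=
  ∑' k : ℕ, (z / 2) ^ (2 * k) / ((k.factorial : ℝ)) ^ 2

lemma gb_cont {f : ℝ → ℝ} {T : ℝ} (hT : 0 ≤ T) (hf : IntervalIntegrable f volume 0 T) :
    ContinuousOn (fun r => ∫ u in (0:ℝ)..r, f u) (Set.Icc 0 T) := by
  have := (hf.absolutelyContinuousOnInterval_intervalIntegral (c := 0) (by simp)).continuousOn
  rwa [Set.uIcc_of_le hT] at this

lemma gb_ac_pow {F : ℝ → ℝ} {a b : ℝ} (h : AbsolutelyContinuousOnInterval F a b) (k : ℕ) :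
    AbsolutelyContinuousOnInterval (fun x => F x ^ (k + 1)) a b := by
  induction k with
  | zero => simpa using h
  | succ n ih =>
    have := ih.fun_mul h
    simpa only [← pow_succ] using this

lemma gb_pow {f : ℝ → ℝ} {s : ℝ} (hf : IntervalIntegrable f volume 0 s) (k : ℕ) :
    ∫ r in (0:ℝ)..s, f r * (∫ u in (0:ℝ)..r, f u) ^ k
      = (∫ u in (0:ℝ)..s, f u) ^ (k + 1) / (k + 1) := by
  have hac := gb_ac_pow
    (hf.absolutelyContinuousOnInterval_intervalIntegral (c := 0) (by simp)) k
  have h1 := hac.integral_deriv_eq_sub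
  have h2 : ∫ r in (0:ℝ)..s, deriv (fun x => (∫ u in (0:ℝ)..x, f u) ^ (k + 1)) r
      = ∫ r in (0:ℝ)..s, ((k:ℝ) + 1) * (f r * (∫ u in (0:ℝ)..r, f u) ^ k) := by
    apply intervalIntegral.integral_congr_ae
    filter_upwards [hf.ae_hasDerivAt_integral] with x hx hxs
    have h3 := (hx (Set.uIoc_subset_uIcc hxs) 0 (by simp)).fun_pow (k + 1)
    rw [h3.deriv]
    push_cast
    try simp only [Nat.add_sub_cancel]
    ring
  rw [h2, intervalIntegral.integral_const_mul] at h1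
  have h4 : ((k:ℝ) + 1) ≠ 0 := by positivity
  rw [eq_div_iff h4, mul_comm, h1]
  simp

lemma gb_series {f : ℝ → ℝ} {s : ℝ} (hs : 0 ≤ s) (hf : IntervalIntegrable f volume 0 s)
    (c : ℕ → ℝ) (hc : ∀ x : ℝ, Summable fun k => c k * x ^ k) :
    HasSum (fun k : ℕ => c k * ((∫ u in (0:ℝ)..s, f u) ^ (k + 1) / (k + 1)))
      (∫ r in (0:ℝ)..s, f r * ∑' k, c k * (∫ u in (0:ℝ)..r, f u) ^ k) := by
  have hcont := gb_cont hs hf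
  obtain ⟨C, hC⟩ := isCompact_Icc.exists_bound_of_continuousOn hcont
  have hsum : Summable fun k => |c k| * |C| ^ k := by
    have := (hc C).abs
    simpa [abs_mul, abs_pow] using this
  have key := intervalIntegral.hasSum_integral_of_dominated_convergence (μ := volume)
    (a := 0) (b := s)
    (F := fun (k : ℕ) r => c k * (f r * (∫ u in (0:ℝ)..r, f u) ^ k))
    (f := fun r => f r * ∑' k, c k * (∫ u in (0:ℝ)..r, f u) ^ k)
    (fun k r => |f r| * (|c k| * |C| ^ k)) ?_ ?_ ?_ ?_ ?_
  · simpa only [intervalIntegral.integral_const_mul, gb_pow hf] using key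
  · intro n
    have : IntervalIntegrable (fun r => c n * (f r * (∫ u in (0:ℝ)..r, f u) ^ n)) volume 0 s := by
      refine (hf.mul_continuousOn ?_).const_mul _
      rw [Set.uIcc_of_le hs]
      exact hcont.pow n
    exact this.aestronglyMeasurable_restrict_uIoc
  · intro n
    refine Filter.Eventually.of_forall fun r hr => ?_
    rw [Set.uIoc_of_le hs] at hr
    have h1 := (hC r ⟨hr.1.le, hr.2⟩).trans (le_abs_self C)
    rw [Real.norm_eq_abs] at h1 ⊢
    rw [abs_mul, abs_mul, abs_pow, mul_left_comm]
    gcongr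
  · exact Filter.Eventually.of_forall fun r _ => hsum.mul_left _
  · simp only [tsum_mul_left]
    exact hf.abs.mul_const _
  · refine Filter.Eventually.of_forall fun r _ => ?_
    have := ((hc (∫ u in (0:ℝ)..r, f u)).hasSum).mul_left (f r)
    have e : (fun k : ℕ => c k * (f r * (∫ u in (0:ℝ)..r, f u) ^ k))
        = fun k => f r * (c k * (∫ u in (0:ℝ)..r, f u) ^ k) := by
      funext k; ring
    simp only [e]
    exact this

lemma gb_summable (x : ℝ) : Summable fun k : ℕ => x ^ k / ((k.factorial : ℝ)) ^ 2 := by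
  refine Summable.of_norm_bounded (Real.summable_pow_div_factorial |x|) fun k => ?_
  have h1 : (1:ℝ) ≤ k.factorial := by exact_mod_cast k.factorial_pos
  rw [Real.norm_eq_abs, abs_div, abs_pow, abs_of_nonneg (by positivity : (0:ℝ) ≤ (k.factorial:ℝ)^2)]
  gcongr
  nlinarith

lemma gb_bessel {x : ℝ} (hx : 0 ≤ x) :
    besselI0 (2 * Real.sqrt x) = ∑' k : ℕ, x ^ k / ((k.factorial : ℝ)) ^ 2 := by
  unfold besselI0
  congr 1; ext k
  rw [mul_div_cancel_left₀ _ (two_ne_zero), pow_mul, Real.sq_sqrt hx]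

lemma gb_contJ : Continuous fun x : ℝ => ∑' k : ℕ, x ^ k / ((k.factorial : ℝ)) ^ 2 := by
  rw [continuous_iff_continuousAt]
  intro x
  have : ContinuousOn (fun x : ℝ => ∑' k : ℕ, x ^ k / ((k.factorial : ℝ)) ^ 2)
      (Metric.ball 0 (|x| + 1)) := by
    refine continuousOn_tsum (u := fun k : ℕ => (|x| + 1) ^ k / ((k.factorial : ℝ)) ^ 2)
      (fun k => by fun_prop) (gb_summable _) ?_
    intro k y hy
    rw [Real.norm_eq_abs, abs_div, abs_pow,
      abs_of_nonneg (by positivity : (0:ℝ) ≤ (k.factorial:ℝ)^2)]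
    have : |y| ≤ |x| + 1 := by
      have := Metric.mem_ball.1 hy
      rw [Real.dist_eq, sub_zero] at this
      exact this.le
    gcongr
  exact this.continuousAt (Metric.isOpen_ball.mem_nhds (by simp))

lemma gb_inner_cont {g : ℝ → ℝ} {T t : ℝ} (ht : t ∈ Set.Icc 0 T)
    (hg : IntervalIntegrable g volume 0 T) {φ : ℝ → ℝ → ℝ}
    (hφ : ContinuousOn (fun p : ℝ × ℝ => φ p.1 p.2) (Set.Icc 0 T ×ˢ Set.Icc 0 T)) :
    ContinuousOn (fun r => ∫ v in (0:ℝ)..t, g v * φ r v) (Set.Icc 0 T) := by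
  obtain ⟨C, hC⟩ := (isCompact_Icc.prod isCompact_Icc).exists_bound_of_continuousOn hφ
  have hT : 0 ≤ T := ht.1.trans ht.2
  have hgt : IntervalIntegrable g volume 0 t := hg.mono_set (by
    rw [Set.uIcc_of_le ht.1, Set.uIcc_of_le hT]; exact Set.Icc_subset_Icc_right ht.2)
  intro r hr
  refine intervalIntegral.continuousWithinAt_of_dominated_interval (bound := fun v => |g v| * C)
    ?_ ?_ (hgt.abs.mul_const _) ?_
  · filter_upwards [self_mem_nhdsWithin] with x hx
    have : IntervalIntegrable (fun v => g v * φ x v) volume 0 t := by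
      refine hgt.mul_continuousOn ?_
      rw [Set.uIcc_of_le ht.1]
      exact hφ.comp (f := fun v => (x, v)) (by fun_prop) fun v hv => ⟨hx, hv.1, hv.2.trans ht.2⟩
    exact this.aestronglyMeasurable_restrict_uIoc
  · filter_upwards [self_mem_nhdsWithin] with x hx
    refine Filter.Eventually.of_forall fun v hv => ?_
    rw [Set.uIoc_of_le ht.1] at hv
    rw [norm_mul]
    exact mul_le_mul_of_nonneg_left (hC (x, v) ⟨hx, hv.1.le, hv.2.trans ht.2⟩) (norm_nonneg _)
  · refine Filter.Eventually.of_forall fun v hv => ?_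
    rw [Set.uIoc_of_le ht.1] at hv
    refine continuousWithinAt_const.mul ?_
    exact (hφ.comp (f := fun x => (x, v)) (by fun_prop)
      fun x hx => ⟨hx, hv.1.le, hv.2.trans ht.2⟩) r hr

lemma gb_bound {f g : ℝ → ℝ} {T : ℝ}
    (hf : IntervalIntegrable f volume 0 T) (hg : IntervalIntegrable g volume 0 T)
    {ψ : ℝ → ℝ → ℝ} {M : ℝ}
    (hM : ∀ s ∈ Set.Icc (0:ℝ) T, ∀ t ∈ Set.Icc (0:ℝ) T, |ψ s t| ≤ M)
    (hψ : ∀ s ∈ Set.Icc (0:ℝ) T, ∀ t ∈ Set.Icc (0:ℝ) T,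
      ψ s t = ∫ r in (0:ℝ)..s, f r * ∫ v in (0:ℝ)..t, g v * ψ r v) (n : ℕ) :
    ∀ s ∈ Set.Icc (0:ℝ) T, ∀ t ∈ Set.Icc (0:ℝ) T,
      |ψ s t| ≤ M * ((∫ u in (0:ℝ)..s, |f u|) ^ n / n.factorial) *
        ((∫ u in (0:ℝ)..t, |g u|) ^ n / n.factorial) := by
  induction n with
  | zero => simpa using hM
  | succ n ih =>
    intro s hs t ht
    have hT : 0 ≤ T := hs.1.trans hs.2
    have sub : ∀ x ∈ Set.Icc (0:ℝ) T, Set.uIcc 0 x ⊆ Set.uIcc 0 T := fun x hx => by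
      rw [Set.uIcc_of_le hx.1, Set.uIcc_of_le hT]; exact Set.Icc_subset_Icc_right hx.2
    have hfs := (hf.mono_set (sub s hs)).abs
    have hgt := (hg.mono_set (sub t ht)).abs
    have cA := gb_cont hs.1 hfs
    have cB := gb_cont ht.1 hgt
    have hin : ∀ r ∈ Set.Icc (0:ℝ) T, |∫ v in (0:ℝ)..t, g v * ψ r v| ≤
        M * ((∫ u in (0:ℝ)..r, |f u|) ^ n / n.factorial) *
        ((∫ u in (0:ℝ)..t, |g u|) ^ (n+1) / (n+1).factorial) := by
      intro r hr
      have := intervalIntegral.norm_integral_le_of_norm_le (μ := volume) (f := fun v => g v * ψ r v)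
        (g := fun v => (M * ((∫ u in (0:ℝ)..r, |f u|) ^ n / n.factorial) / n.factorial) *
          (|g v| * (∫ u in (0:ℝ)..v, |g u|) ^ n)) ht.1 ?_ ?_
      · refine this.trans_eq ?_
        rw [intervalIntegral.integral_const_mul, gb_pow hgt, Nat.factorial_succ]
        push_cast
        field_simp
      · refine Filter.Eventually.of_forall fun v hv => ?_
        rw [norm_mul, Real.norm_eq_abs, Real.norm_eq_abs]
        refine (mul_le_mul_of_nonneg_left (ih r hr v ⟨hv.1.le, hv.2.trans ht.2⟩)
          (abs_nonneg _)).trans_eq ?_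
        ring
      · refine (hgt.mul_continuousOn ?_).const_mul _
        rw [Set.uIcc_of_le ht.1]
        exact cB.pow n
    rw [hψ s hs t ht]
    have := intervalIntegral.norm_integral_le_of_norm_le (μ := volume)
        (f := fun r => f r * ∫ v in (0:ℝ)..t, g v * ψ r v)
        (g := fun r => (M / n.factorial * ((∫ u in (0:ℝ)..t, |g u|) ^ (n+1) / (n+1).factorial)) *
          (|f r| * (∫ u in (0:ℝ)..r, |f u|) ^ n)) hs.1 ?_ ?_
    · refine this.trans_eq ?_
      rw [intervalIntegral.integral_const_mul, gb_pow hfs, Nat.factorial_succ]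
      push_cast
      field_simp
    · refine Filter.Eventually.of_forall fun v hv => ?_
      rw [norm_mul, Real.norm_eq_abs, Real.norm_eq_abs]
      refine (mul_le_mul_of_nonneg_left (hin v ⟨hv.1.le, hv.2.trans hs.2⟩)
        (abs_nonneg _)).trans_eq ?_
      ring
    · refine (hfs.mul_continuousOn ?_).const_mul _
      rw [Set.uIcc_of_le hs.1]
      exact cA.pow n

lemma gb_zero {f g : ℝ → ℝ} {T : ℝ}
    (hf : IntervalIntegrable f volume 0 T) (hg : IntervalIntegrable g volume 0 T)
    {ψ : ℝ → ℝ → ℝ} {M : ℝ}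
    (hM : ∀ s ∈ Set.Icc (0:ℝ) T, ∀ t ∈ Set.Icc (0:ℝ) T, |ψ s t| ≤ M)
    (hψ : ∀ s ∈ Set.Icc (0:ℝ) T, ∀ t ∈ Set.Icc (0:ℝ) T,
      ψ s t = ∫ r in (0:ℝ)..s, f r * ∫ v in (0:ℝ)..t, g v * ψ r v) :
    ∀ s ∈ Set.Icc (0:ℝ) T, ∀ t ∈ Set.Icc (0:ℝ) T, ψ s t = 0 := by
  intro s hs t ht
  have hb := fun n => gb_bound hf hg hM hψ n s hs t ht
  have h1 := FloorSemiring.tendsto_pow_div_factorial_atTop (∫ u in (0:ℝ)..s, |f u|)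
  have h2 := FloorSemiring.tendsto_pow_div_factorial_atTop (∫ u in (0:ℝ)..t, |g u|)
  have h3 := (h1.const_mul M).mul h2
  have h4 := ge_of_tendsto' h3 hb
  simp only [mul_zero] at h4
  exact abs_nonpos_iff.1 h4

/-- **Explicit Bessel solution of the multiplicative Goursat integral equation**: for integrable
`f, g : [0,T] → ℝ` with nonnegative primitives `F, G`, the unique continuous solution of
`φ(s,t) = 1 + ∫_0^s ∫_0^t f(r) g(v) φ(r,v) dr dv` on `[0,T]²` is
`φ(s,t) = I₀(2 √(F(s) G(t)))`. -/
theorem goursat_bessel_solution (T : ℝ) (hT : 0 < T) (f g : ℝ → ℝ)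
    (hf : IntervalIntegrable f volume 0 T) (hg : IntervalIntegrable g volume 0 T)
    (hF : ∀ t ∈ Set.Icc (0:ℝ) T, 0 ≤ ∫ u in (0:ℝ)..t, f u)
    (hG : ∀ t ∈ Set.Icc (0:ℝ) T, 0 ≤ ∫ u in (0:ℝ)..t, g u) :
    -- the Bessel formula is a continuous solution …
    (ContinuousOn
        (fun p : ℝ × ℝ =>
          besselI0 (2 * Real.sqrt ((∫ u in (0:ℝ)..p.1, f u) * ∫ u in (0:ℝ)..p.2, g u)))
        (Set.Icc 0 T ×ˢ Set.Icc 0 T) ∧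
      ∀ s ∈ Set.Icc (0:ℝ) T, ∀ t ∈ Set.Icc (0:ℝ) T,
        besselI0 (2 * Real.sqrt ((∫ u in (0:ℝ)..s, f u) * ∫ u in (0:ℝ)..t, g u))
          = 1 + ∫ r in (0:ℝ)..s, ∫ v in (0:ℝ)..t, f r * g v *
              besselI0 (2 * Real.sqrt ((∫ u in (0:ℝ)..r, f u) * ∫ u in (0:ℝ)..v, g u))) ∧
    -- … and it is the unique continuous solution
    (∀ φ : ℝ → ℝ → ℝ,
      ContinuousOn (fun p : ℝ × ℝ => φ p.1 p.2) (Set.Icc 0 T ×ˢ Set.Icc 0 T) →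
      (∀ s ∈ Set.Icc (0:ℝ) T, ∀ t ∈ Set.Icc (0:ℝ) T,
        φ s t = 1 + ∫ r in (0:ℝ)..s, ∫ v in (0:ℝ)..t, f r * g v * φ r v) →
      ∀ s ∈ Set.Icc (0:ℝ) T, ∀ t ∈ Set.Icc (0:ℝ) T,
        φ s t = besselI0 (2 * Real.sqrt ((∫ u in (0:ℝ)..s, f u) * ∫ u in (0:ℝ)..t, g u))) := by
  have sub : ∀ x ∈ Set.Icc (0:ℝ) T, Set.uIcc 0 x ⊆ Set.uIcc 0 T := fun x hx => by
    rw [Set.uIcc_of_le hx.1, Set.uIcc_of_le hT.le]; exact Set.Icc_subset_Icc_right hx.2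
  have cF := gb_cont hT.le hf
  have cG := gb_cont hT.le hg
  have hcont : ContinuousOn
        (fun p : ℝ × ℝ =>
          besselI0 (2 * Real.sqrt ((∫ u in (0:ℝ)..p.1, f u) * ∫ u in (0:ℝ)..p.2, g u)))
        (Set.Icc 0 T ×ˢ Set.Icc 0 T) := by
    have h1 : ContinuousOn (fun p : ℝ × ℝ => (∫ u in (0:ℝ)..p.1, f u) * ∫ u in (0:ℝ)..p.2, g u)
        (Set.Icc 0 T ×ˢ Set.Icc 0 T) :=
      (cF.comp continuousOn_fst fun p hp => hp.1).mul (cG.comp continuousOn_snd fun p hp => hp.2)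
    refine (gb_contJ.comp_continuousOn h1).congr fun p hp => ?_
    exact gb_bessel (mul_nonneg (hF _ hp.1) (hG _ hp.2))
  have hsol : ∀ s ∈ Set.Icc (0:ℝ) T, ∀ t ∈ Set.Icc (0:ℝ) T,
        besselI0 (2 * Real.sqrt ((∫ u in (0:ℝ)..s, f u) * ∫ u in (0:ℝ)..t, g u))
          = 1 + ∫ r in (0:ℝ)..s, ∫ v in (0:ℝ)..t, f r * g v *
              besselI0 (2 * Real.sqrt ((∫ u in (0:ℝ)..r, f u) * ∫ u in (0:ℝ)..v, g u)) := by
    intro s hs t ht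
    have hfs := hf.mono_set (sub s hs)
    have hgt := hg.mono_set (sub t ht)
    have hin : ∀ r ∈ Set.Icc (0:ℝ) T, ∫ v in (0:ℝ)..t, f r * g v *
              besselI0 (2 * Real.sqrt ((∫ u in (0:ℝ)..r, f u) * ∫ u in (0:ℝ)..v, g u))
        = f r * ∑' k : ℕ, ((∫ u in (0:ℝ)..t, g u) ^ (k + 1) / (k + 1) / (k.factorial:ℝ) ^ 2) *
            (∫ u in (0:ℝ)..r, f u) ^ k := by
      intro r hr
      have h1 := gb_series ht.1 hgt
        (fun k => (∫ u in (0:ℝ)..r, f u) ^ k / (k.factorial:ℝ) ^ 2) (fun x => by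
          refine (gb_summable ((∫ u in (0:ℝ)..r, f u) * x)).congr fun k => ?_
          rw [mul_pow]; ring)
      have h2 : ∫ v in (0:ℝ)..t, f r * g v *
              besselI0 (2 * Real.sqrt ((∫ u in (0:ℝ)..r, f u) * ∫ u in (0:ℝ)..v, g u))
          = f r * ∫ v in (0:ℝ)..t, g v * ∑' k : ℕ,
            (∫ u in (0:ℝ)..r, f u) ^ k / (k.factorial:ℝ) ^ 2 * (∫ u in (0:ℝ)..v, g u) ^ k := by
        rw [← intervalIntegral.integral_const_mul]
        refine intervalIntegral.integral_congr fun v hv => ?_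
        rw [Set.uIcc_of_le ht.1] at hv
        rw [gb_bessel (mul_nonneg (hF r hr) (hG v ⟨hv.1, hv.2.trans ht.2⟩)), mul_assoc]
        congr 3
        ext k
        rw [mul_pow]; ring
      rw [h2, ← h1.tsum_eq]
      congr 2
      ext k
      ring
    have hout : ∫ r in (0:ℝ)..s, ∫ v in (0:ℝ)..t, f r * g v *
              besselI0 (2 * Real.sqrt ((∫ u in (0:ℝ)..r, f u) * ∫ u in (0:ℝ)..v, g u))
        = ∫ r in (0:ℝ)..s, f r * ∑' k : ℕ,
          ((∫ u in (0:ℝ)..t, g u) ^ (k + 1) / (k + 1) / (k.factorial:ℝ) ^ 2) *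
            (∫ u in (0:ℝ)..r, f u) ^ k := by
      refine intervalIntegral.integral_congr fun r hr => ?_
      rw [Set.uIcc_of_le hs.1] at hr
      exact hin r ⟨hr.1, hr.2.trans hs.2⟩
    have h1 := gb_series hs.1 hfs
        (fun k => (∫ u in (0:ℝ)..t, g u) ^ (k + 1) / (k + 1) / (k.factorial:ℝ) ^ 2) (fun x => by
          refine Summable.of_norm_bounded
            (((gb_summable ((∫ u in (0:ℝ)..t, g u) * x)).abs).mul_left
              |∫ u in (0:ℝ)..t, g u|) fun k => ?_
          rw [Real.norm_eq_abs, ← abs_mul]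
          have e : (∫ u in (0:ℝ)..t, g u) ^ (k + 1) / (k + 1) / (k.factorial:ℝ) ^ 2 * x ^ k
            = ((∫ u in (0:ℝ)..t, g u) * (((∫ u in (0:ℝ)..t, g u) * x) ^ k /
              (k.factorial:ℝ) ^ 2)) / ((k:ℝ) + 1) := by
            rw [mul_pow]; ring
          rw [e, abs_div]
          refine div_le_self (abs_nonneg _) ?_
          rw [abs_of_nonneg (by positivity)]
          have : (0:ℝ) ≤ k := k.cast_nonneg
          linarith)
    rw [hout, ← h1.tsum_eq, gb_bessel (mul_nonneg (hF s hs) (hG t ht)),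
      (gb_summable _).tsum_eq_zero_add]
    congr 1
    · simp
    · congr 1
      ext k
      rw [Nat.factorial_succ, mul_pow]
      push_cast
      field_simp
  refine ⟨⟨hcont, hsol⟩, ?_⟩
  intro φ hφ hφs s hs t ht
  set B : ℝ → ℝ → ℝ := fun s t =>
    besselI0 (2 * Real.sqrt ((∫ u in (0:ℝ)..s, f u) * ∫ u in (0:ℝ)..t, g u)) with hB
  have hBc : ContinuousOn (fun p : ℝ × ℝ => B p.1 p.2) (Set.Icc 0 T ×ˢ Set.Icc 0 T) := hcont
  have hBs : ∀ s ∈ Set.Icc (0:ℝ) T, ∀ t ∈ Set.Icc (0:ℝ) T,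
      B s t = 1 + ∫ r in (0:ℝ)..s, ∫ v in (0:ℝ)..t, f r * g v * B r v := hsol
  obtain ⟨M, hM⟩ := (isCompact_Icc.prod isCompact_Icc).exists_bound_of_continuousOn (hφ.sub hBc)
  have hint : ∀ ρ : ℝ → ℝ → ℝ,
      ContinuousOn (fun p : ℝ × ℝ => ρ p.1 p.2) (Set.Icc 0 T ×ˢ Set.Icc 0 T) →
      ∀ t ∈ Set.Icc (0:ℝ) T, ∀ r ∈ Set.Icc (0:ℝ) T,
      IntervalIntegrable (fun v => g v * ρ r v) volume 0 t := by
    intro ρ hρ t ht r hr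
    refine (hg.mono_set (sub t ht)).mul_continuousOn ?_
    rw [Set.uIcc_of_le ht.1]
    exact hρ.comp (f := fun v => (r, v)) (by fun_prop) fun v hv => ⟨hr, hv.1, hv.2.trans ht.2⟩
  have hint2 : ∀ ρ : ℝ → ℝ → ℝ,
      ContinuousOn (fun p : ℝ × ℝ => ρ p.1 p.2) (Set.Icc 0 T ×ˢ Set.Icc 0 T) →
      ∀ t ∈ Set.Icc (0:ℝ) T, ∀ s ∈ Set.Icc (0:ℝ) T,
      IntervalIntegrable (fun r => f r * ∫ v in (0:ℝ)..t, g v * ρ r v) volume 0 s := by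
    intro ρ hρ t ht s hs
    refine (hf.mono_set (sub s hs)).mul_continuousOn ?_
    rw [Set.uIcc_of_le hs.1]
    exact (gb_inner_cont ht hg hρ).mono (Set.Icc_subset_Icc_right hs.2)
  have hz := gb_zero hf hg (ψ := fun s t => φ s t - B s t) (M := M)
    (fun s hs t ht => hM (s, t) ⟨hs, ht⟩) ?_ s hs t ht
  · exact sub_eq_zero.1 hz
  · intro s hs t ht
    rw [hφs s hs t ht, hBs s hs t ht]
    simp only [mul_assoc, intervalIntegral.integral_const_mul]
    rw [add_sub_add_left_eq_sub, ← intervalIntegral.integral_sub (hint2 φ hφ t ht s hs)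
      (hint2 B hBc t ht s hs)]
    refine intervalIntegral.integral_congr fun r hr => ?_
    rw [Set.uIcc_of_le hs.1] at hr
    have hr' : r ∈ Set.Icc 0 T := ⟨hr.1, hr.2.trans hs.2⟩
    beta_reduce
    rw [← mul_sub, ← intervalIntegral.integral_sub (hint φ hφ t ht r hr') (hint B hBc t ht r hr')]
    simp only [mul_sub]
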